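/- arXiv:0909.3503 — 4 statements merged into one kernel-verified Lean document; each statement's English description precedes it below -/
import Mathlib

section
/- There exists a positive constant C such that for every τ > 0 and every ξ ∈ (−C₀, C₀), one has |Y_{ξξ}(τ, ξ) / Y_ξ(τ, ξ)| ≤ C (e^{μ τ} − 1), where μ = f'(a). -/
lemma aux_partial_smooth (G : ℝ × ℝ → ℝ) (hG : ContDiff ℝ (⊤ : ℕ∞) G) :
    ContDiff ℝ (⊤ : ℕ∞) (fun p : ℝ × ℝ => deriv (fun η => G (p.1, η)) p.2) := by
  have h : (fun p : ℝ × ℝ => deriv (fun η => G (p.1, η)) p.2)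
      = fun p => fderiv ℝ G p (0, 1) := by
    funext p
    have h1 : HasFDerivAt G (fderiv ℝ G p) (p.1, p.2) :=
      (hG.differentiable (by simp) p).hasFDerivAt
    have h2 : HasDerivAt (fun η : ℝ => (p.1, η)) ((0 : ℝ), (1 : ℝ)) p.2 :=
      (hasDerivAt_const _ _).prodMk (hasDerivAt_id _)
    exact (h1.comp_hasDerivAt p.2 h2).deriv
  rw [h]
  exact (hG.fderiv_right (m := (⊤ : ℕ∞)) (by simp)).clm_apply contDiff_const

lemma aux_mixed (G : ℝ × ℝ → ℝ) (hG : ContDiff ℝ (⊤ : ℕ∞) G) (τ ξ : ℝ) :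
    HasDerivAt (fun s => deriv (fun ζ => G (s, ζ)) ξ)
      (deriv (fun η => deriv (fun s => G (s, η)) τ) ξ) τ := by
  have hd : ∀ p, HasFDerivAt G (fderiv ℝ G p) p := fun p =>
      (hG.differentiable (by simp) p).hasFDerivAt
  have e2 : ∀ s x : ℝ, HasDerivAt (fun η : ℝ => (s, η)) ((0 : ℝ), (1 : ℝ)) x := fun s x =>
      (hasDerivAt_const _ _).prodMk (hasDerivAt_id _)
  have e1 : ∀ s x : ℝ, HasDerivAt (fun t : ℝ => (t, x)) ((1 : ℝ), (0 : ℝ)) s := fun s x =>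
      (hasDerivAt_id _).prodMk (hasDerivAt_const _ _)
  have h2 : ∀ s x : ℝ, deriv (fun η => G (s, η)) x = fderiv ℝ G (s, x) (0, 1) := fun s x =>
    ((hd (s, x)).comp_hasDerivAt x (e2 s x)).deriv
  have h1 : ∀ s x : ℝ, deriv (fun t => G (t, x)) s = fderiv ℝ G (s, x) (1, 0) := fun s x =>
    ((hd (s, x)).comp_hasDerivAt s (e1 s x)).deriv
  simp_rw [h1, h2]
  have hG' : ContDiff ℝ (⊤ : ℕ∞) (fderiv ℝ G) := hG.fderiv_right (m := (⊤ : ℕ∞)) (by simp)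
  have hdd : HasFDerivAt (fderiv ℝ G) (fderiv ℝ (fderiv ℝ G) (τ, ξ)) (τ, ξ) :=
    (hG'.differentiable (by simp) _).hasFDerivAt
  have k1 : HasDerivAt (fun s => fderiv ℝ G (s, ξ) (0, 1))
      (fderiv ℝ (fderiv ℝ G) (τ, ξ) (1, 0) (0, 1)) τ := by
    have hh := hdd.comp_hasDerivAt τ (e1 τ ξ)
    exact (ContinuousLinearMap.apply ℝ ℝ ((0:ℝ), (1:ℝ))).hasFDerivAt.comp_hasDerivAt τ hh
  have k2 : HasDerivAt (fun x => fderiv ℝ G (τ, x) (1, 0))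
      (fderiv ℝ (fderiv ℝ G) (τ, ξ) (0, 1) (1, 0)) ξ := by
    have hh := hdd.comp_hasDerivAt ξ (e2 τ ξ)
    exact (ContinuousLinearMap.apply ℝ ℝ ((1:ℝ), (0:ℝ))).hasFDerivAt.comp_hasDerivAt ξ hh
  rw [k2.deriv, second_derivative_symmetric hd hdd (0, 1) (1, 0)]
  exact k1

lemma aux_neg_right (f : ℝ → ℝ) (hf : Continuous f) (b : ℝ) (hb : f b = 0)
    (hd : deriv f b < 0) (hz : ∀ s, b < s → f s ≠ 0) : ∀ s, b < s → f s < 0 := by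
  intro s hs
  by_contra hcon
  push Not at hcon
  have hdiff : HasDerivAt f (deriv f b) b :=
    (differentiableAt_of_deriv_ne_zero hd.ne).hasDerivAt
  have hslope := hasDerivAt_iff_tendsto_slope.1 hdiff
  have hev : ∀ᶠ x in nhdsWithin b (Set.Ioi b), slope f b x < 0 :=
    (hslope.mono_left (nhdsWithin_mono b (fun x hx => ne_of_gt hx))).eventually_lt_const hd
  have hev2 : ∀ᶠ x in nhdsWithin b (Set.Ioi b), x ∈ Set.Ioo b s := Ioo_mem_nhdsGT hs
  obtain ⟨x, hx1, hx2⟩ := (hev.and hev2).exists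
  have hfx : f x < 0 := by
    rw [slope_def_field, hb, sub_zero] at hx1
    by_contra h
    push Not at h
    exact absurd (div_nonneg h (sub_pos.2 hx2.1).le) (not_le.2 hx1)
  obtain ⟨y, hy, hy0⟩ := intermediate_value_Icc hx2.2.le hf.continuousOn ⟨hfx.le, hcon⟩
  exact hz y (lt_of_lt_of_le hx2.1 hy.1) hy0

lemma aux_pos_left (f : ℝ → ℝ) (hf : Continuous f) (b : ℝ) (hb : f b = 0)
    (hd : deriv f b < 0) (hz : ∀ s, s < b → f s ≠ 0) : ∀ s, s < b → 0 < f s := by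
  intro s hs
  have hdiff : HasDerivAt f (deriv f (- -b)) (- -b) := by
    rw [neg_neg]; exact (differentiableAt_of_deriv_ne_zero hd.ne).hasDerivAt
  have hg : HasDerivAt (fun x => - f (-x)) (deriv f b) (-b) := by
    have h := (hdiff.comp (-b) (hasDerivAt_neg (-b))).neg
    refine HasDerivAt.congr_deriv (f' := -(deriv f (- -b) * -1)) h ?_
    simp
  have := aux_neg_right (fun x => - f (-x)) (by fun_prop) (-b) (by simp [hb])
    (by rw [hg.deriv]; exact hd)
    (fun t ht => neg_ne_zero.2 (hz _ (by linarith))) (-s) (by linarith)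
  simpa using this

lemma aux_local (f : ℝ → ℝ) (a : ℝ) (hf : ContDiff ℝ (⊤ : ℕ∞) f)
    (hzeros : ∀ s, f s = 0 → s = 0 ∨ s = a ∨ s = 1)
    (hd0 : deriv f 0 < 0) (hda : 0 < deriv f a) (hd1 : deriv f 1 < 0) (y : ℝ) :
    ∃ K ≥ (0:ℝ), ∀ᶠ x in nhds y, deriv f x - deriv f a ≤ K * |f x| := by
  have hf' : ContDiff ℝ (⊤ : ℕ∞) (deriv f) := (contDiff_infty_iff_deriv.1 hf).2
  have hc : Continuous (fun x => deriv f x - deriv f a) := by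
    have := hf'.continuous; fun_prop
  have hneg : deriv f y < 0 → ∃ K ≥ (0:ℝ), ∀ᶠ x in nhds y,
      deriv f x - deriv f a ≤ K * |f x| := by
    intro h
    refine ⟨0, le_rfl, ?_⟩
    filter_upwards [hc.continuousAt.eventually_lt_const (show deriv f y - deriv f a < 0 by linarith)]
      with x hx
    simpa using hx.le
  have hO : (fun x => deriv f x - deriv f a) =O[nhds y] f → ∃ K ≥ (0:ℝ), ∀ᶠ x in nhds y,
      deriv f x - deriv f a ≤ K * |f x| := by
    intro h
    obtain ⟨K, hK, hb⟩ := h.exists_nonneg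
    refine ⟨K, hK, ?_⟩
    filter_upwards [hb.bound] with x hx
    exact (le_abs_self _).trans hx
  by_cases h0 : f y = 0
  · rcases hzeros y h0 with rfl | rfl | rfl
    · exact hneg hd0
    · apply hO
      have e1 : (fun x => deriv f x - deriv f y) =O[nhds y] fun x => x - y :=
        (hf'.differentiable (by simp) y).hasDerivAt.isBigO_sub
      have e2 : (fun x => x - y) =O[nhds y] fun x => f x - f y :=
        (((hf.differentiable (by simp) y).hasDerivAt.isTheta_sub hda.ne').isBigO_symm).comp_tendsto
          (k := fun x => (x, y)) (Filter.tendsto_id.prodMk (Filter.tendsto_const_pure))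
      simp only [h0, sub_zero] at e2
      exact e1.trans e2
    · exact hneg hd1
  · apply hO
    have e1 : (fun x => deriv f x - deriv f a) =O[nhds y] fun _ => (1:ℝ) :=
      hc.continuousAt.tendsto.isBigO_one ℝ
    have e2 : (fun _ => (1:ℝ)) =O[nhds y] f :=
      (Asymptotics.isBigO_const_left_iff_pos_le_norm one_ne_zero).2
        ⟨|f y| / 2, by positivity, by
          have := (hf.continuous.abs.continuousAt (x := y)).eventually_const_lt
            (show |f y| / 2 < |f y| by have := abs_pos.2 h0; linarith)
          filter_upwards [this] with x hx
          exact hx.le⟩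
    exact e1.trans e2

lemma aux_global (f : ℝ → ℝ) (a : ℝ) (hf : ContDiff ℝ (⊤ : ℕ∞) f)
    (hzeros : ∀ s, f s = 0 → s = 0 ∨ s = a ∨ s = 1)
    (hd0 : deriv f 0 < 0) (hda : 0 < deriv f a) (hd1 : deriv f 1 < 0) (M : ℝ) :
    ∃ K ≥ (0:ℝ), ∀ x ∈ Set.Icc (-M) M, deriv f x - deriv f a ≤ K * |f x| := by
  refine (isCompact_Icc (a := -M) (b := M)).induction_on
    (p := fun s => ∃ K ≥ (0:ℝ), ∀ x ∈ s, deriv f x - deriv f a ≤ K * |f x|) ?_ ?_ ?_ ?_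
  · exact ⟨0, le_rfl, by simp⟩
  · rintro s t hst ⟨K, hK, h⟩
    exact ⟨K, hK, fun x hx => h x (hst hx)⟩
  · rintro s t ⟨K, hK, h⟩ ⟨L, hL, h'⟩
    refine ⟨K + L, by linarith, ?_⟩
    rintro x (hx | hx)
    · have := h x hx
      nlinarith [abs_nonneg (f x)]
    · have := h' x hx
      nlinarith [abs_nonneg (f x)]
  · intro y _
    obtain ⟨K, hK, h⟩ := aux_local f a hf hzeros hd0 hda hd1 y
    exact ⟨_, mem_nhdsWithin_of_mem_nhds h, K, hK, fun x hx => hx⟩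

/-- **Estimate on `Y_ξξ / Y_ξ`** (Lemma 4.5 (iv)).  There is a constant `C > 0` such
that for every `τ > 0` and every `ξ ∈ (−C₀, C₀)`,
`|Y_ξξ(τ, ξ) / Y_ξ(τ, ξ)| ≤ C (e^{μ τ} − 1)` where `μ = f'(a)`. -/
theorem ode_second_derivative_ratio_bound
    (f : ℝ → ℝ) (a : ℝ)
    (hf : ContDiff ℝ (⊤ : ℕ∞) f) (ha0 : 0 < a) (ha1 : a < 1)
    (hf0 : f 0 = 0) (hfa : f a = 0) (hf1 : f 1 = 0)
    (hzeros : ∀ s, f s = 0 → s = 0 ∨ s = a ∨ s = 1)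
    (hd0 : deriv f 0 < 0) (hda : 0 < deriv f a) (hd1 : deriv f 1 < 0)
    (C₀ : ℝ) (hC₀ : 0 < C₀)
    (Y : ℝ → ℝ → ℝ)
    (hY0 : ∀ ξ ∈ Set.Ioo (-C₀) C₀, Y 0 ξ = ξ)
    (hYode : ∀ ξ ∈ Set.Ioo (-C₀) C₀, ∀ τ ≥ (0:ℝ),
      HasDerivAt (fun s => Y s ξ) (f (Y τ ξ)) τ)
    -- `Y` is smooth in `(τ, ξ)` and `Y_ξ > 0`
    (hYsmooth : ContDiff ℝ (⊤ : ℕ∞) (fun p : ℝ × ℝ => Y p.1 p.2))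
    (hYξpos : ∀ τ > (0:ℝ), ∀ ξ ∈ Set.Ioo (-C₀) C₀, 0 < deriv (fun η => Y τ η) ξ) :
    ∃ C > (0:ℝ), ∀ τ > (0:ℝ), ∀ ξ ∈ Set.Ioo (-C₀) C₀,
      |deriv (fun η => deriv (fun ζ => Y τ ζ) η) ξ / deriv (fun η => Y τ η) ξ|
        ≤ C * (Real.exp (deriv f a * τ) - 1) := by
  set μ := deriv f a with hμ
  have hf' : ContDiff ℝ (⊤ : ℕ∞) (deriv f) := (contDiff_infty_iff_deriv.1 hf).2
  have hf'' : ContDiff ℝ (⊤ : ℕ∞) (deriv (deriv f)) := (contDiff_infty_iff_deriv.1 hf').2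
  have hdf : ∀ x, HasDerivAt f (deriv f x) x := fun x =>
    (hf.differentiable (by simp) x).hasDerivAt
  have hdf' : ∀ x, HasDerivAt (deriv f) (deriv (deriv f) x) x := fun x =>
    (hf'.differentiable (by simp) x).hasDerivAt
  -- the two space derivatives
  set V : ℝ → ℝ → ℝ := fun τ ξ => deriv (fun η => Y τ η) ξ with hV
  set W : ℝ → ℝ → ℝ := fun τ ξ => deriv (fun η => V τ η) ξ with hW
  have hVs : ContDiff ℝ (⊤ : ℕ∞) (fun p : ℝ × ℝ => V p.1 p.2) :=
    aux_partial_smooth (fun p : ℝ × ℝ => Y p.1 p.2) hYsmooth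
  have hYx : ∀ τ ξ, HasDerivAt (fun η => Y τ η) (V τ ξ) ξ := fun τ ξ =>
    ((hYsmooth.comp (contDiff_prodMk_right τ)).differentiable (by simp) ξ).hasDerivAt
  have hVx : ∀ τ ξ, HasDerivAt (fun η => V τ η) (W τ ξ) ξ := fun τ ξ =>
    ((hVs.comp (contDiff_prodMk_right τ)).differentiable (by simp) ξ).hasDerivAt
  have hnhds : ∀ ξ ∈ Set.Ioo (-C₀) C₀, ∀ᶠ η in nhds ξ, η ∈ Set.Ioo (-C₀) C₀ :=
    fun ξ hξ => isOpen_Ioo.mem_nhds hξ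
  have hVt : ∀ ξ ∈ Set.Ioo (-C₀) C₀, ∀ τ ≥ (0:ℝ),
      HasDerivAt (fun s => V s ξ) (deriv f (Y τ ξ) * V τ ξ) τ := by
    intro ξ hξ τ hτ
    have h := aux_mixed (fun p : ℝ × ℝ => Y p.1 p.2) hYsmooth τ ξ
    have e : (fun η => deriv (fun s => Y s η) τ) =ᶠ[nhds ξ] fun η => f (Y τ η) := by
      filter_upwards [hnhds ξ hξ] with η hη
      exact (hYode η hη τ hτ).deriv
    have e2 : HasDerivAt (fun η => f (Y τ η)) (deriv f (Y τ ξ) * V τ ξ) ξ :=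
      (hdf (Y τ ξ)).comp ξ (hYx τ ξ)
    have e3 := e.deriv_eq.trans e2.deriv
    rw [← e3]
    exact h
  have hWt : ∀ ξ ∈ Set.Ioo (-C₀) C₀, ∀ τ ≥ (0:ℝ),
      HasDerivAt (fun s => W s ξ)
        (deriv (deriv f) (Y τ ξ) * V τ ξ * V τ ξ + deriv f (Y τ ξ) * W τ ξ) τ := by
    intro ξ hξ τ hτ
    have h := aux_mixed (fun p : ℝ × ℝ => V p.1 p.2) hVs τ ξ
    have e : (fun η => deriv (fun s => V s η) τ) =ᶠ[nhds ξ]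
        fun η => deriv f (Y τ η) * V τ η := by
      filter_upwards [hnhds ξ hξ] with η hη
      exact (hVt η hη τ hτ).deriv
    have e2 : HasDerivAt (fun η => deriv f (Y τ η) * V τ η)
        (deriv (deriv f) (Y τ ξ) * V τ ξ * V τ ξ + deriv f (Y τ ξ) * W τ ξ) ξ :=
      ((hdf' (Y τ ξ)).comp ξ (hYx τ ξ)).mul (hVx τ ξ)
    have e3 := e.deriv_eq.trans e2.deriv
    rw [← e3]
    exact h
  have hV0 : ∀ ξ ∈ Set.Ioo (-C₀) C₀, V 0 ξ = 1 := by
    intro ξ hξ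
    have e : (fun η => Y 0 η) =ᶠ[nhds ξ] fun η => η := by
      filter_upwards [hnhds ξ hξ] with η hη
      exact hY0 η hη
    exact e.deriv_eq.trans (deriv_id ξ)
  have hW0 : ∀ ξ ∈ Set.Ioo (-C₀) C₀, W 0 ξ = 0 := by
    intro ξ hξ
    have e : (fun η => V 0 η) =ᶠ[nhds ξ] fun η => (1:ℝ) := by
      filter_upwards [hnhds ξ hξ] with η hη
      exact hV0 η hη
    exact e.deriv_eq.trans (deriv_const ξ 1)
  have hVpos : ∀ ξ ∈ Set.Ioo (-C₀) C₀, ∀ τ ≥ (0:ℝ), 0 < V τ ξ := by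
    intro ξ hξ τ hτ
    rcases hτ.lt_or_eq with h | h
    · exact hYξpos τ h ξ hξ
    · rw [← h, hV0 ξ hξ]; exact one_pos
  -- `f (Y) = f ξ * Y_ξ`
  have hfY : ∀ ξ ∈ Set.Ioo (-C₀) C₀, ∀ τ ≥ (0:ℝ), f (Y τ ξ) = f ξ * V τ ξ := by
    intro ξ hξ τ hτ
    have hd : ∀ t ≥ (0:ℝ), HasDerivAt (fun s => f (Y s ξ) / V s ξ) 0 t := by
      intro t ht
      have h1 : HasDerivAt (fun s => f (Y s ξ)) (deriv f (Y t ξ) * f (Y t ξ)) t :=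
        (hdf (Y t ξ)).comp t (hYode ξ hξ t ht)
      have h2 := h1.div (hVt ξ hξ t ht) (hVpos ξ hξ t ht).ne'
      refine HasDerivAt.congr_deriv h2 ?_
      have := (hVpos ξ hξ t ht).ne'
      field_simp
      ring
    have := constant_of_has_deriv_right_zero (a := 0) (b := τ)
      (f := fun s => f (Y s ξ) / V s ξ)
      (fun t ht => (hd t ht.1).continuousAt.continuousWithinAt)
      (fun t ht => (hd t ht.1).hasDerivWithinAt) τ ⟨hτ, le_rfl⟩
    simp only [hV0 ξ hξ, hY0 ξ hξ, div_one] at this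
    rwa [div_eq_iff (hVpos ξ hξ τ hτ).ne'] at this
  -- boundedness of `Y`
  have hneg := aux_neg_right f hf.continuous 1 hf1 hd1 (fun s hs h => by
    rcases hzeros s h with h | h | h <;> linarith)
  have hpos := aux_pos_left f hf.continuous 0 hf0 hd0 (fun s hs h => by
    rcases hzeros s h with h | h | h <;> linarith)
  set M := max C₀ 1 with hM
  have hMC : C₀ ≤ M := le_max_left _ _
  have hM1 : 1 ≤ M := le_max_right _ _
  have hYc : ∀ ξ ∈ Set.Ioo (-C₀) C₀, ContinuousOn (fun s => Y s ξ) (Set.Ici 0) :=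
    fun ξ hξ t ht => (hYode ξ hξ t ht).continuousAt.continuousWithinAt
  have hub : ∀ ξ ∈ Set.Ioo (-C₀) C₀, ∀ τ ≥ (0:ℝ), Y τ ξ ≤ M := by
    intro ξ hξ τ hτ
    rcases le_or_gt (f ξ) 0 with h | h
    · have hanti : AntitoneOn (fun s => Y s ξ) (Set.Ici 0) := by
        refine antitoneOn_of_hasDerivWithinAt_nonpos (convex_Ici 0) (hYc ξ hξ)
          (f' := fun t => f (Y t ξ)) ?_ ?_
        · intro t ht
          exact (hYode ξ hξ t (interior_subset ht)).hasDerivWithinAt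
        · intro t ht
          have ht' : (0:ℝ) ≤ t := interior_subset ht
          change f (Y t ξ) ≤ 0
          rw [hfY ξ hξ t ht']
          exact mul_nonpos_of_nonpos_of_nonneg h (hVpos ξ hξ t ht').le
      have := hanti (Set.mem_Ici.2 le_rfl) (Set.mem_Ici.2 hτ) hτ
      simp only [hY0 ξ hξ] at this
      linarith [hξ.2]
    · have hξ1 : ξ ≤ 1 := by
        by_contra hc
        exact absurd (hneg ξ (not_le.1 hc)) (not_lt.2 h.le)
      refine le_trans ?_ hM1
      by_contra hc
      obtain ⟨t, ht, hty⟩ := intermediate_value_Icc hτ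
        ((hYc ξ hξ).mono (fun x hx => hx.1) : ContinuousOn (fun s => Y s ξ) (Set.Icc 0 τ))
        (⟨by simp only [hY0 ξ hξ]; exact hξ1, (not_le.1 hc).le⟩ :
          (1:ℝ) ∈ Set.Icc (Y 0 ξ) (Y τ ξ))
      have h1 := hfY ξ hξ t ht.1
      simp only at hty
      rw [hty, hf1] at h1
      exact absurd (mul_pos h (hVpos ξ hξ t ht.1)) (by rw [← h1]; exact lt_irrefl 0)
  have hlb : ∀ ξ ∈ Set.Ioo (-C₀) C₀, ∀ τ ≥ (0:ℝ), -M ≤ Y τ ξ := by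
    intro ξ hξ τ hτ
    rcases le_or_gt 0 (f ξ) with h | h
    · have hmono : MonotoneOn (fun s => Y s ξ) (Set.Ici 0) := by
        refine monotoneOn_of_hasDerivWithinAt_nonneg (convex_Ici 0) (hYc ξ hξ)
          (f' := fun t => f (Y t ξ)) ?_ ?_
        · intro t ht
          exact (hYode ξ hξ t (interior_subset ht)).hasDerivWithinAt
        · intro t ht
          have ht' : (0:ℝ) ≤ t := interior_subset ht
          change 0 ≤ f (Y t ξ)
          rw [hfY ξ hξ t ht']
          exact mul_nonneg h (hVpos ξ hξ t ht').le
      have := hmono (Set.mem_Ici.2 le_rfl) (Set.mem_Ici.2 hτ) hτ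
      simp only [hY0 ξ hξ] at this
      linarith [hξ.1]
    · have hξ1 : 0 ≤ ξ := by
        by_contra hc
        exact absurd (hpos ξ (not_le.1 hc)) (not_lt.2 h.le)
      refine le_trans (by linarith : -M ≤ 0) ?_
      by_contra hc
      obtain ⟨t, ht, hty⟩ := intermediate_value_Icc' hτ
        ((hYc ξ hξ).mono (fun x hx => hx.1) : ContinuousOn (fun s => Y s ξ) (Set.Icc 0 τ))
        (⟨(not_le.1 hc).le, by simp only [hY0 ξ hξ]; exact hξ1⟩ :
          (0:ℝ) ∈ Set.Icc (Y τ ξ) (Y 0 ξ))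
      have h1 := hfY ξ hξ t ht.1
      simp only at hty
      rw [hty, hf0] at h1
      exact absurd (mul_neg_of_neg_of_pos h (hVpos ξ hξ t ht.1))
        (by rw [← h1]; exact lt_irrefl 0)
  -- bound on `Y_ξ`
  obtain ⟨K, hK, hKb⟩ := aux_global f a hf hzeros hd0 hda hd1 M
  have hsig : ∀ ξ ∈ Set.Ioo (-C₀) C₀, ∃ σ : ℝ, |σ| ≤ 1 ∧ ∀ t ≥ (0:ℝ),
      |f (Y t ξ)| = σ * f (Y t ξ) := by
    intro ξ hξ
    rcases le_or_gt 0 (f ξ) with h | h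
    · refine ⟨1, by simp, fun t ht => ?_⟩
      rw [one_mul, abs_of_nonneg]
      rw [hfY ξ hξ t ht]
      exact mul_nonneg h (hVpos ξ hξ t ht).le
    · refine ⟨-1, by simp, fun t ht => ?_⟩
      rw [neg_one_mul, abs_of_neg]
      rw [hfY ξ hξ t ht]
      exact mul_neg_of_neg_of_pos h (hVpos ξ hξ t ht)
  have hVb : ∀ ξ ∈ Set.Ioo (-C₀) C₀, ∀ τ ≥ (0:ℝ),
      V τ ξ ≤ Real.exp (2 * K * M) * Real.exp (μ * τ) := by
    intro ξ hξ τ hτ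
    obtain ⟨σ, hσ, hσf⟩ := hsig ξ hξ
    have hE : ∀ t ≥ (0:ℝ), HasDerivAt
        (fun s => V s ξ * Real.exp (-(K * σ * Y s ξ) - μ * s))
        (V t ξ * Real.exp (-(K * σ * Y t ξ) - μ * t) *
          (deriv f (Y t ξ) - μ - K * |f (Y t ξ)|)) t := by
      intro t ht
      have h1 : HasDerivAt (fun s => -(K * σ * Y s ξ) - μ * s)
          (-(K * σ * f (Y t ξ)) - μ * 1) t :=
        ((hYode ξ hξ t ht).const_mul (K * σ)).neg.sub ((hasDerivAt_id t).const_mul μ)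
      have h2 := (hVt ξ hξ t ht).mul h1.exp
      refine HasDerivAt.congr_deriv h2 ?_
      rw [hσf t ht]
      ring
    have hanti : AntitoneOn (fun s => V s ξ * Real.exp (-(K * σ * Y s ξ) - μ * s))
        (Set.Ici 0) := by
      refine antitoneOn_of_hasDerivWithinAt_nonpos (convex_Ici 0)
        (fun t ht => (hE t ht).continuousAt.continuousWithinAt)
        (fun t ht => (hE t (interior_subset ht)).hasDerivWithinAt) ?_
      intro t ht
      have ht' : (0:ℝ) ≤ t := interior_subset ht
      have := hKb (Y t ξ) ⟨hlb ξ hξ t ht', hub ξ hξ t ht'⟩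
      exact mul_nonpos_of_nonneg_of_nonpos
        (mul_pos (hVpos ξ hξ t ht') (Real.exp_pos _)).le (by linarith)
    have h := hanti (Set.mem_Ici.2 le_rfl) (Set.mem_Ici.2 hτ) hτ
    simp only [hY0 ξ hξ, hV0 ξ hξ, one_mul, mul_zero, sub_zero] at h
    have h3 : V τ ξ ≤ Real.exp (-(K * σ * ξ) - (-(K * σ * Y τ ξ) - μ * τ)) := by
      rw [Real.exp_sub, le_div_iff₀ (Real.exp_pos _)]
      exact h
    refine h3.trans ?_
    rw [← Real.exp_add]
    apply Real.exp_le_exp.2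
    have h4 : |σ * (Y τ ξ - ξ)| ≤ 2 * M := by
      rw [abs_mul]
      have h5 : |Y τ ξ - ξ| ≤ 2 * M := by
        rw [abs_le]
        constructor <;> linarith [hlb ξ hξ τ hτ, hub ξ hξ τ hτ, hξ.1, hξ.2]
      calc |σ| * |Y τ ξ - ξ| ≤ 1 * |Y τ ξ - ξ| := by gcongr
        _ ≤ 2 * M := by rw [one_mul]; exact h5
    have h6 := mul_le_mul_of_nonneg_left ((le_abs_self _).trans h4) hK
    linarith
  -- bound on `f''`
  obtain ⟨B, hB⟩ := (isCompact_Icc (a := -M) (b := M)).exists_bound_of_continuousOn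
    hf''.continuous.continuousOn
  have hB0 : 0 ≤ B := (norm_nonneg _).trans (hB 0 ⟨by linarith, by linarith⟩)
  set L := (B + 1) * Real.exp (2 * K * M) with hL
  have hLpos : 0 < L := by positivity
  refine ⟨L / μ, by positivity, ?_⟩
  intro τ hτ ξ hξ
  change |W τ ξ / V τ ξ| ≤ _
  have hA : ∀ t ≥ (0:ℝ), HasDerivAt (fun s => W s ξ / V s ξ)
      (deriv (deriv f) (Y t ξ) * V t ξ) t := by
    intro t ht
    have h2 := (hWt ξ hξ t ht).div (hVt ξ hξ t ht) (hVpos ξ hξ t ht).ne'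
    refine HasDerivAt.congr_deriv h2 ?_
    have := (hVpos ξ hξ t ht).ne'
    field_simp
    ring
  have hR : ∀ t : ℝ, HasDerivAt (fun s => L / μ * (Real.exp (μ * s) - 1))
      (L * Real.exp (μ * t)) t := by
    intro t
    have h1 := ((((hasDerivAt_id t).const_mul μ).exp).sub_const 1).const_mul (L / μ)
    refine HasDerivAt.congr_deriv h1 ?_
    have := hda.ne'
    simp only [id]
    field_simp
  have := image_norm_le_of_norm_deriv_right_le_deriv_boundary (a := 0) (b := τ)
    (f := fun s => W s ξ / V s ξ)
    (f' := fun t => deriv (deriv f) (Y t ξ) * V t ξ)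
    (B := fun s => L / μ * (Real.exp (μ * s) - 1)) (B' := fun t => L * Real.exp (μ * t))
    (fun t ht => (hA t ht.1).continuousAt.continuousWithinAt)
    (fun t ht => (hA t ht.1).hasDerivWithinAt)
    (by simp [hW0 ξ hξ]) hR
    (fun t ht => by
      have h1 := hB (Y t ξ) ⟨hlb ξ hξ t ht.1, hub ξ hξ t ht.1⟩
      have h2 := hVb ξ hξ t ht.1
      have h3 := hVpos ξ hξ t ht.1
      rw [norm_mul, Real.norm_of_nonneg h3.le, hL, mul_assoc]
      exact mul_le_mul (by linarith) h2 h3.le (by linarith))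
  exact this ⟨hτ.le, le_rfl⟩
end

section
/- Let γ ∈ (0, min(a, 1−a)) be arbitrary and μ = f'(a). There exists ε₀ > 0 such that for all ε ∈ (0, ε₀) and all ξ ∈ (−C₀, C₀), one has −γ ≤ Y(μ^{-1} |ln ε|, ξ) ≤ 1 + γ. -/
lemma sign_aux (g : ℝ → ℝ) (p d : ℝ) (hg : Continuous g) (hp : g p = 0)
    (hd : HasDerivAt g d p) (hneg : d < 0) (hz : ∀ x, p < x → g x ≠ 0) :
    ∀ x, p < x → g x < 0 := by
  intro x hx
  by_contra! hcon
  have h1 := hd.tendsto_slope.mono_left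
    (nhdsWithin_mono p (fun y (hy : y ∈ Set.Ioi p) => ne_of_gt hy))
  have h2 := h1.eventually (gt_mem_nhds hneg)
  have h3 : ∀ᶠ y in nhdsWithin p (Set.Ioi p), y ∈ Set.Ioo p x := Ioo_mem_nhdsGT hx
  obtain ⟨y, hy, hy2⟩ := (h2.and h3).exists
  have hgy : g y < 0 := by
    rw [slope_def_field, hp, sub_zero] at hy
    have hpos : 0 < y - p := sub_pos.2 hy2.1
    by_contra! h
    exact absurd hy (not_lt.2 (div_nonneg h hpos.le))
  obtain ⟨z, hz1, hz2⟩ := intermediate_value_Icc hy2.2.le hg.continuousOn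
    (show (0:ℝ) ∈ Set.Icc (g y) (g x) from ⟨hgy.le, hcon⟩)
  exact hz z (lt_of_lt_of_le hy2.1 hz1.1) hz2

lemma barrier_aux (g : ℝ → ℝ) (c M : ℝ) (hg : Continuous g) (hn : ∀ x, c ≤ x → g x < 0)
    (hcM : c ≤ M) :
    ∃ T₀ : ℝ, 0 ≤ T₀ ∧ ∀ y : ℝ → ℝ, y 0 ≤ M → (∀ t ≥ (0:ℝ), HasDerivAt y (g (y t)) t) →
      ∀ t ≥ T₀, y t ≤ c := by
  obtain ⟨x₀, hx₀, hmax⟩ := isCompact_Icc.exists_isMaxOn (Set.nonempty_Icc.2 hcM)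
    (hg.continuousOn (s := Set.Icc c M))
  have hm : g x₀ < 0 := hn x₀ hx₀.1
  obtain ⟨k, hk⟩ : ∃ k, k = -(g x₀) / 2 := ⟨_, rfl⟩
  have hk0 : 0 < k := by rw [hk]; linarith
  have hT : 0 ≤ (M - c) / k := div_nonneg (by linarith) hk0.le
  refine ⟨(M - c) / k, hT, ?_⟩
  intro y hy0 hy t ht
  have step1 : y ((M - c) / k) ≤ c := by
    have h := image_le_of_deriv_right_lt_deriv_boundary (f := y) (f' := fun t => g (y t))
      (a := 0) (b := (M - c) / k) (B := fun t => M - k * t) (B' := fun _ => -k)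
      (fun t ht => (hy t ht.1).continuousAt.continuousWithinAt)
      (fun t ht => (hy t ht.1).hasDerivWithinAt) (by simpa using hy0)
      (fun t => by simpa using ((hasDerivAt_id t).const_mul k).const_sub M)
      (fun t ht he => by
        have h1 : k * t ≤ M - c := by
          have := (le_div_iff₀ hk0).1 ht.2.le
          linarith
        have h2 : 0 ≤ k * t := mul_nonneg hk0.le ht.1
        have h3 : g (y t) ≤ g x₀ := hmax (by rw [he]; constructor <;> linarith)
        linarith)
      (Set.right_mem_Icc.2 hT)
    have h4 : k * ((M - c) / k) = M - c := by field_simp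
    simp only [h4] at h
    linarith
  exact image_le_of_deriv_right_lt_deriv_boundary (f := y) (f' := fun t => g (y t))
      (a := (M - c) / k) (b := t) (B := fun _ => c) (B' := fun _ => 0)
      (fun t ht => (hy t (hT.trans ht.1)).continuousAt.continuousWithinAt)
      (fun t ht => (hy t (hT.trans ht.1)).hasDerivWithinAt) step1
      (fun t => hasDerivAt_const t c)
      (fun t ht he => hn _ he.ge)
      (Set.right_mem_Icc.2 ht)

/-- **Bounds for `Y` after a time of order `|ln ε|`** (Lemma 4.6 (i)).  Let
`γ ∈ (0, min(a, 1−a))` and `μ = f'(a)`.  There exists `ε₀ > 0` such that for all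
`ε ∈ (0, ε₀)` and all `ξ ∈ (−C₀, C₀)`, `−γ ≤ Y(μ⁻¹ |ln ε|, ξ) ≤ 1 + γ`. -/
theorem ode_bounds_after_generation_time
    (f : ℝ → ℝ) (a : ℝ)
    (hf : ContDiff ℝ (⊤ : ℕ∞) f) (ha0 : 0 < a) (ha1 : a < 1)
    (hf0 : f 0 = 0) (hfa : f a = 0) (hf1 : f 1 = 0)
    (hzeros : ∀ s, f s = 0 → s = 0 ∨ s = a ∨ s = 1)
    (hd0 : deriv f 0 < 0) (hda : 0 < deriv f a) (hd1 : deriv f 1 < 0)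
    (C₀ : ℝ) (hC₀ : 0 < C₀)
    (Y : ℝ → ℝ → ℝ)
    (hY0 : ∀ ξ ∈ Set.Ioo (-C₀) C₀, Y 0 ξ = ξ)
    (hYode : ∀ ξ ∈ Set.Ioo (-C₀) C₀, ∀ τ ≥ (0:ℝ),
      HasDerivAt (fun s => Y s ξ) (f (Y τ ξ)) τ)
    (γ : ℝ) (hγ : γ ∈ Set.Ioo 0 (min a (1 - a))) :
    ∃ ε₀ > (0:ℝ), ∀ ε ∈ Set.Ioo (0:ℝ) ε₀, ∀ ξ ∈ Set.Ioo (-C₀) C₀,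
      -γ ≤ Y ((deriv f a)⁻¹ * |Real.log ε|) ξ ∧
      Y ((deriv f a)⁻¹ * |Real.log ε|) ξ ≤ 1 + γ := by
  have hdiff : Differentiable ℝ f := hf.differentiable (by simp)
  have hcont : Continuous f := hf.continuous
  have hγ0 : 0 < γ := hγ.1
  have hup := sign_aux f 1 _ hcont hf1 (hdiff 1).hasDerivAt hd1 (by
    intro x hx h
    rcases hzeros x h with h | h | h <;> linarith)
  have hgc : Continuous (fun x => -f (-x)) := by fun_prop
  have hlo := sign_aux (fun x => -f (-x)) 0 (deriv f 0) hgc (by simp [hf0]) (by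
      have h0 : HasDerivAt f (deriv f 0) (-(0:ℝ)) := by
        rw [neg_zero]; exact (hdiff 0).hasDerivAt
      have h1 := (h0.comp (0:ℝ) (hasDerivAt_neg (0:ℝ))).neg
      have h2 : -(deriv f 0 * -1) = deriv f 0 := by ring
      rw [h2] at h1
      exact h1) hd0 (by
    intro x hx h
    rcases hzeros (-x) (by simpa using h) with h | h | h <;> linarith)
  obtain ⟨T₁, hT₁, H₁⟩ := barrier_aux f (1 + γ) (max C₀ (1 + γ)) hcont
    (fun x hx => hup x (by linarith)) (le_max_right _ _)
  obtain ⟨T₂, hT₂, H₂⟩ := barrier_aux _ γ (max C₀ γ) hgc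
    (fun x hx => hlo x (by linarith)) (le_max_right _ _)
  refine ⟨Real.exp (-(deriv f a * max T₁ T₂)), Real.exp_pos _, ?_⟩
  intro ε hε ξ hξ
  have ht : max T₁ T₂ ≤ (deriv f a)⁻¹ * |Real.log ε| := by
    rw [inv_mul_eq_div, le_div_iff₀ hda]
    have h1 := (Real.log_lt_iff_lt_exp hε.1).2 hε.2
    have h2 := neg_le_abs (Real.log ε)
    linarith
  constructor
  · have h := H₂ (fun s => -Y s ξ)
      (by
        simp only [hY0 ξ hξ]
        exact le_trans (by linarith [hξ.1]) (le_max_left _ _))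
      (fun t ht => by simp only [neg_neg]; exact (hYode ξ hξ t ht).neg) _ ((le_max_right _ _).trans ht)
    linarith
  · exact H₁ (fun s => Y s ξ)
      (by
        simp only [hY0 ξ hξ]
        exact le_trans hξ.2.le (le_max_left _ _))
      (fun t ht => hYode ξ hξ t ht) _ ((le_max_left _ _).trans ht)
end

section
/- Let γ ∈ (0, min(a, 1−a)) be arbitrary and μ = f'(a). There exist positive constants ε₀ and C_Y such that for all ε ∈ (0, ε₀) and all ξ ∈ (−C₀, C₀): if ξ ≥ a + C_Y ε then Y(μ^{-1} |ln ε|, ξ) ≥ 1 − γ, and if ξ ≤ a − C_Y ε then Y(μ^{-1} |ln ε|, ξ) ≤ γ. -/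
open Set in
lemma core_quad (f : ℝ → ℝ) (a b : ℝ) (hf : ContDiff ℝ (⊤ : ℕ∞) f) (hab : a < b)
    (hfa : f a = 0) :
    ∃ M > 0, ∀ s ∈ Icc a b, deriv f a * (s - a) - M * (s - a)^2 ≤ f s := by
  obtain ⟨C, hC⟩ := exists_taylor_mean_remainder_bound (n := 1) hab.le
    ((contDiff_infty.1 hf (1 + 1)).contDiffOn (s := Icc a b))
  refine ⟨|C| + 1, by positivity, fun s hs => ?_⟩
  have h := hC s hs
  have hd : derivWithin f (Icc a b) a = deriv f a :=
    (hf.differentiable (by simp) a).derivWithin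
      (uniqueDiffOn_Icc hab a (left_mem_Icc.2 hab.le))
  rw [taylorWithinEval_succ, taylor_within_zero_eval] at h
  simp [iteratedDerivWithin_one, hd, hfa] at h
  have h2 := (abs_le.1 h).1
  have h3 := le_abs_self C
  nlinarith [mul_le_mul_of_nonneg_right h3 (sq_nonneg (s - a)), sq_nonneg (s-a)]

open Set in
lemma core_pos (f : ℝ → ℝ) (a b : ℝ) (hf : ContDiff ℝ (⊤ : ℕ∞) f) (hab : a < b)
    (hfa : f a = 0) (hda : 0 < deriv f a) (hz : ∀ s ∈ Ioc a b, f s ≠ 0) :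
    ∀ s ∈ Ioc a b, 0 < f s := by
  obtain ⟨M, hM, hq⟩ := core_quad f a b hf hab hfa
  intro s hs
  by_contra hneg
  push Not at hneg
  set u := min (s - a) (deriv f a / (2 * M)) with hu
  have hu0 : 0 < u := lt_min (by linarith [hs.1]) (by positivity)
  have hu1 : u ≤ s - a := min_le_left _ _
  have hu2 : u * (2 * M) ≤ deriv f a := (le_div_iff₀ (by positivity)).1 (min_le_right _ _)
  have h1 := hq (a + u) ⟨by linarith, by linarith [hs.2]⟩
  have h2 : 0 < f (a + u) := by
    refine lt_of_lt_of_le ?_ h1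
    have : a + u - a = u := by ring
    rw [this]
    nlinarith [mul_pos hu0 hda]
  obtain ⟨z, hz1, hz2⟩ := intermediate_value_Icc' (by linarith : a + u ≤ s)
    hf.continuous.continuousOn (show (0:ℝ) ∈ Icc (f s) (f (a+u)) from ⟨hneg, h2.le⟩)
  exact hz z ⟨by linarith [hz1.1], by linarith [hz1.2, hs.2]⟩ hz2

open Set in
lemma core_K (f : ℝ → ℝ) (a b : ℝ) (hf : ContDiff ℝ (⊤ : ℕ∞) f) (hab : a < b)
    (hfa : f a = 0) (hda : 0 < deriv f a) (hz : ∀ s ∈ Ioc a b, f s ≠ 0) :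
    ∃ K > 0, ∀ s ∈ Ioc a b, deriv f a * (s - a) ≤ f s * (1 + K * (s - a)) := by
  obtain ⟨M, hM, hq⟩ := core_quad f a b hf hab hfa
  have hp := core_pos f a b hf hab hfa hda hz
  set μ := deriv f a with hμ
  set d := min (b - a) (μ / (2 * M)) with hd
  have hd0 : 0 < d := lt_min (by linarith) (by positivity)
  have hd1 : d ≤ b - a := min_le_left _ _
  have hd2 : d * (2 * M) ≤ μ := (le_div_iff₀ (by positivity)).1 (min_le_right _ _)
  obtain ⟨x, hx, hmin⟩ := (isCompact_Icc (a := a + d) (b := b)).exists_isMinOn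
    ⟨b, by linarith, le_rfl⟩ hf.continuous.continuousOn
  have hm : 0 < f x := hp x ⟨by linarith [hx.1], hx.2⟩
  set K := max (2 * M / μ) (μ / f x) with hK
  have hK1 : 2 * M ≤ K * μ := (div_le_iff₀ hda).1 (le_max_left _ _)
  have hK2 : μ ≤ K * f x := (div_le_iff₀ hm).1 (le_max_right _ _)
  have hK0 : 0 < K := lt_of_lt_of_le (by positivity) (le_max_left _ _)
  refine ⟨K, hK0, fun s hs => ?_⟩
  have hu : 0 < s - a := by linarith [hs.1]
  rcases le_total (s - a) d with h | h
  · have h1 := hq s ⟨hs.1.le, hs.2⟩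
    generalize s - a = u at *
    have h2 : (μ * u - M * u ^ 2) * (1 + K * u) ≤ f s * (1 + K * u) :=
      mul_le_mul_of_nonneg_right h1 (by positivity)
    have h3 : u * (2 * M) ≤ μ := by nlinarith
    have h4 : 0 ≤ K * μ - M - K * M * u := by nlinarith
    nlinarith [mul_nonneg (sq_nonneg u) h4]
  · have h1 : f x ≤ f s := hmin ⟨by linarith, hs.2⟩
    have h2 : μ ≤ K * f s := by nlinarith
    nlinarith [hp s hs]

open Set in
lemma core_barrier (f : ℝ → ℝ) (y : ℝ → ℝ)
    (hy : ∀ t ≥ (0:ℝ), HasDerivAt y (f (y t)) t) (c : ℝ) (hc : 0 < f c)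
    (t₀ t₁ : ℝ) (h0 : 0 ≤ t₀) (h1 : t₀ ≤ t₁) (hyc : c ≤ y t₀) : c ≤ y t₁ := by
  refine image_le_of_deriv_right_lt_deriv_boundary' (f := fun _ => c) (f' := fun _ => 0)
    (a := t₀) (b := t₁) (B := y) (B' := fun t => f (y t)) continuousOn_const
    (fun x _ => hasDerivWithinAt_const _ _ _) hyc
    (fun x hx => (hy x (h0.trans hx.1)).continuousAt.continuousWithinAt)
    (fun x hx => (hy x (h0.trans hx.1)).hasDerivWithinAt)
    (fun x hx hcx => ?_) (right_mem_Icc.2 h1)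
  simpa [← hcx] using hc

open Set in
lemma core_main (f : ℝ → ℝ) (a b : ℝ) (hf : ContDiff ℝ (⊤ : ℕ∞) f) (hab : a < b)
    (hfa : f a = 0) (hda : 0 < deriv f a) (hz : ∀ s ∈ Ioc a b, f s ≠ 0) :
    ∃ C > 0, ∀ ε ∈ Ioo (0:ℝ) 1, ∀ y : ℝ → ℝ,
      (∀ t ≥ (0:ℝ), HasDerivAt y (f (y t)) t) → a + C * ε ≤ y 0 →
      b ≤ y ((deriv f a)⁻¹ * |Real.log ε|) := by
  obtain ⟨K, hK, hKf⟩ := core_K f a b hf hab hfa hda hz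
  have hp := core_pos f a b hf hab hfa hda hz
  refine ⟨Real.exp (Real.log (b - a) + K * (b - a)), Real.exp_pos _, ?_⟩
  set C := Real.exp (Real.log (b - a) + K * (b - a)) with hC
  intro ε hε y hy hy0
  set T := (deriv f a)⁻¹ * |Real.log ε| with hT
  have hT0 : 0 ≤ T := by positivity
  by_contra hlt
  push Not at hlt
  have hyb : ∀ t ∈ Icc 0 T, y t < b := by
    intro t ht
    by_contra h
    push Not at h
    linarith [core_barrier f y hy b (hp b ⟨hab, le_rfl⟩) t T ht.1 ht.2 h]
  have hCε : 0 < C * ε := mul_pos (Real.exp_pos _) hε.1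
  have hya : ∀ t ∈ Icc 0 T, a < y t := by
    intro t ht
    have h0b := hyb 0 ⟨le_rfl, hT0⟩
    linarith [core_barrier f y hy (y 0) (hp _ ⟨by linarith, h0b.le⟩) 0 t le_rfl ht.1 le_rfl]
  have hder : ∀ t ∈ Icc 0 T, HasDerivAt
      (fun t => Real.log (y t - a) + K * (y t - a) - deriv f a * t)
      (f (y t) / (y t - a) + K * f (y t) - deriv f a * 1) t := by
    intro t ht
    have h1 := (hy t ht.1).sub_const a
    have h2 := hya t ht
    exact ((h1.log (by linarith)).add (h1.const_mul K)).sub ((hasDerivAt_id t).const_mul _)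
  have hmono := monotoneOn_of_deriv_nonneg (convex_Icc 0 T)
    (fun t ht => (hder t ht).continuousAt.continuousWithinAt)
    (fun t ht => (hder t (interior_subset ht)).differentiableAt.differentiableWithinAt)
    (fun t ht => by
      have ht' := interior_subset ht
      rw [(hder t ht').deriv]
      have h2 : 0 < y t - a := by linarith [hya t ht']
      have h3 := hKf (y t) ⟨hya t ht', (hyb t ht').le⟩
      have h4 : deriv f a ≤ f (y t) * (1 + K * (y t - a)) / (y t - a) :=
        (le_div_iff₀ h2).2 h3
      have h5 : f (y t) * (1 + K * (y t - a)) / (y t - a)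
          = f (y t) / (y t - a) + K * f (y t) := by field_simp
      linarith)
  have hfin := hmono (left_mem_Icc.2 hT0) (right_mem_Icc.2 hT0) hT0
  simp only [mul_zero, sub_zero] at hfin
  have hμT : deriv f a * T = - Real.log ε := by
    rw [hT, abs_of_neg (Real.log_neg hε.1 hε.2)]
    field_simp
  have hlog0 : Real.log (C * ε) ≤ Real.log (y 0 - a) := Real.log_le_log hCε (by linarith)
  rw [Real.log_mul (Real.exp_pos _).ne' hε.1.ne', Real.log_exp] at hlog0
  have hTa := hya T (right_mem_Icc.2 hT0)
  have h0a := hya 0 (left_mem_Icc.2 hT0)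
  have hlogT : Real.log (y T - a) < Real.log (b - a) :=
    Real.log_lt_log (by linarith) (by linarith)
  nlinarith [mul_pos hK (sub_pos.2 hlt), mul_pos hK (sub_pos.2 h0a)]

/-- **Stabilization of `Y` near the stable equilibria** (Lemma 4.6 (ii)).  Let
`γ ∈ (0, min(a, 1−a))` and `μ = f'(a)`.  There exist positive constants `ε₀` and
`C_Y` such that for all `ε ∈ (0, ε₀)` and all `ξ ∈ (−C₀, C₀)`: if `ξ ≥ a + C_Y ε`
then `Y(μ⁻¹ |ln ε|, ξ) ≥ 1 − γ`, and if `ξ ≤ a − C_Y ε` then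
`Y(μ⁻¹ |ln ε|, ξ) ≤ γ`. -/
theorem ode_stabilization_near_equilibria
    (f : ℝ → ℝ) (a : ℝ)
    (hf : ContDiff ℝ (⊤ : ℕ∞) f) (ha0 : 0 < a) (ha1 : a < 1)
    (hf0 : f 0 = 0) (hfa : f a = 0) (hf1 : f 1 = 0)
    (hzeros : ∀ s, f s = 0 → s = 0 ∨ s = a ∨ s = 1)
    (hd0 : deriv f 0 < 0) (hda : 0 < deriv f a) (hd1 : deriv f 1 < 0)
    (C₀ : ℝ) (hC₀ : 0 < C₀)
    (Y : ℝ → ℝ → ℝ)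
    (hY0 : ∀ ξ ∈ Set.Ioo (-C₀) C₀, Y 0 ξ = ξ)
    (hYode : ∀ ξ ∈ Set.Ioo (-C₀) C₀, ∀ τ ≥ (0:ℝ),
      HasDerivAt (fun s => Y s ξ) (f (Y τ ξ)) τ)
    (γ : ℝ) (hγ : γ ∈ Set.Ioo 0 (min a (1 - a))) :
    ∃ ε₀ > (0:ℝ), ∃ CY > (0:ℝ), ∀ ε ∈ Set.Ioo (0:ℝ) ε₀, ∀ ξ ∈ Set.Ioo (-C₀) C₀,
      (a + CY * ε ≤ ξ → 1 - γ ≤ Y ((deriv f a)⁻¹ * |Real.log ε|) ξ) ∧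
      (ξ ≤ a - CY * ε → Y ((deriv f a)⁻¹ * |Real.log ε|) ξ ≤ γ) := by
  obtain ⟨hγ0, hγ1⟩ := hγ
  have hγa : γ < a := lt_of_lt_of_le hγ1 (min_le_left _ _)
  have hγb : γ < 1 - a := lt_of_lt_of_le hγ1 (min_le_right _ _)
  obtain ⟨C1, hC1, H1⟩ := core_main f a (1 - γ) hf (by linarith) hfa hda (by
    intro s hs h
    rcases hzeros s h with h | h | h <;> linarith [hs.1, hs.2])
  have hdg : deriv (fun s => - f (-s)) (-a) = deriv f a := by
    rw [deriv.fun_neg, deriv_comp_neg]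
    simp
  obtain ⟨C2, hC2, H2⟩ := core_main (fun s => - f (-s)) (-a) (-γ)
    (hf.comp contDiff_neg).neg (by linarith) (by simp [hfa]) (by rw [hdg]; exact hda) (by
      intro s hs h
      rcases hzeros (-s) (by simpa using h) with h | h | h <;> linarith [hs.1, hs.2])
  rw [hdg] at H2
  refine ⟨1, one_pos, max C1 C2, lt_max_of_lt_left hC1, fun ε hε ξ hξ => ⟨fun h => ?_, fun h => ?_⟩⟩
  · refine H1 ε hε (fun s => Y s ξ) (hYode ξ hξ) ?_
    have := mul_le_mul_of_nonneg_right (le_max_left C1 C2) hε.1.le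
    simp only [hY0 ξ hξ]
    linarith
  · have h2 := H2 ε hε (fun s => - Y s ξ)
      (fun t ht => by simpa using (hYode ξ hξ t ht).fun_neg) (by
        have := mul_le_mul_of_nonneg_right (le_max_right C1 C2) hε.1.le
        simp only [hY0 ξ hξ]
        linarith)
    simpa using h2
end

section
/- Let η ∈ (0, min(a, 1−a)) be arbitrary and μ = f'(a). Then there exist positive constants C₁ = C₁(η) and C₂ = C₂(η) such that for every ξ ∈ (a, 1−η) and every τ > 0 with the property that Y(s, ξ) remains in the interval (a, 1−η) for all s ∈ [0, τ], one has C₁ e^{μ τ} (ξ − a) ≤ Y(τ, ξ) − a ≤ C₂ e^{μ τ} (ξ − a). -/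
/-- **Exponential growth estimate for the bistable ODE** (Lemma 4.7).  Let
`η ∈ (0, min(a, 1−a))` and `μ = f'(a)`.  There exist positive constants `C₁ = C₁(η)`
and `C₂ = C₂(η)` such that for every `ξ ∈ (a, 1−η)` and every `τ > 0` with the
property that `Y(s, ξ)` remains in `(a, 1−η)` for all `s ∈ [0, τ]`, one has
`C₁ e^{μ τ} (ξ − a) ≤ Y(τ, ξ) − a ≤ C₂ e^{μ τ} (ξ − a)`. -/
theorem ode_exponential_growth_estimate
    (f : ℝ → ℝ) (a : ℝ)
    (hf : ContDiff ℝ (⊤ : ℕ∞) f) (ha0 : 0 < a) (ha1 : a < 1)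
    (hf0 : f 0 = 0) (hfa : f a = 0) (hf1 : f 1 = 0)
    (hzeros : ∀ s, f s = 0 → s = 0 ∨ s = a ∨ s = 1)
    (hd0 : deriv f 0 < 0) (hda : 0 < deriv f a) (hd1 : deriv f 1 < 0)
    (Y : ℝ → ℝ → ℝ)
    (hY0 : ∀ ξ : ℝ, Y 0 ξ = ξ)
    (hYode : ∀ ξ : ℝ, ∀ τ ≥ (0:ℝ), HasDerivAt (fun s => Y s ξ) (f (Y τ ξ)) τ)
    (η : ℝ) (hη : η ∈ Set.Ioo 0 (min a (1 - a))) :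
    ∃ C₁ > (0:ℝ), ∃ C₂ > (0:ℝ), ∀ ξ ∈ Set.Ioo a (1 - η), ∀ τ > (0:ℝ),
      (∀ s ∈ Set.Icc (0:ℝ) τ, Y s ξ ∈ Set.Ioo a (1 - η)) →
      C₁ * Real.exp (deriv f a * τ) * (ξ - a) ≤ Y τ ξ - a ∧
      Y τ ξ - a ≤ C₂ * Real.exp (deriv f a * τ) * (ξ - a) := by
  obtain ⟨hη0, hη1⟩ := hη
  have hη2 : η < 1 - a := lt_of_lt_of_le hη1 (min_le_right _ _)
  have hab : a < 1 - η := by linarith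
  have hdiff : Differentiable ℝ f := hf.differentiable (by simp)
  -- the difference quotient
  have hgc : Continuous (dslope f a) := by
    rw [continuous_iff_continuousAt]
    intro x
    by_cases hx : x = a
    · subst hx
      exact continuousAt_dslope_same.2 (hdiff x)
    · exact (continuousAt_dslope_of_ne hx).2 hdiff.continuous.continuousAt
  have hga : dslope f a a = deriv f a := dslope_same f a
  have hfg : ∀ y, (y - a) * dslope f a y = f y := by
    intro y
    have := sub_smul_dslope f a y
    simpa [hfa] using this
  have hgpos : ∀ y ∈ Set.Icc a (1 - η), 0 < dslope f a y := by
    intro y hy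
    by_contra hneg
    push Not at hneg
    have h0 : (0:ℝ) ∈ Set.Icc (dslope f a y) (dslope f a a) := ⟨hneg, by rw [hga]; exact hda.le⟩
    obtain ⟨z, hz, hz0⟩ := intermediate_value_Icc' hy.1 hgc.continuousOn h0
    have hfz : f z = 0 := by rw [← hfg z, hz0, mul_zero]
    rcases hzeros z hfz with h | h | h
    · linarith [hz.1]
    · rw [h, hga] at hz0
      linarith
    · linarith [hz.2, hy.2]
  obtain ⟨y0, hy0, hmin⟩ := isCompact_Icc.exists_isMinOn (Set.nonempty_Icc.2 hab.le)
    (hgc.continuousOn (s := Set.Icc a (1 - η)))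
  set c := dslope f a y0 with hc
  have hcpos : 0 < c := hgpos y0 hy0
  have hcle : ∀ y ∈ Set.Icc a (1 - η), c ≤ dslope f a y := fun y hy => hmin hy
  -- Taylor
  obtain ⟨K, hK⟩ : ∃ K, ∀ x ∈ Set.Icc a (1 - η),
      |f x - deriv f a * (x - a)| ≤ K * (x - a) ^ 2 := by
    obtain ⟨K, hK⟩ := exists_taylor_mean_remainder_bound (n := 1) hab.le
      ((contDiff_infty.1 hf (1 + 1)).contDiffOn (s := Set.Icc a (1 - η)))
    refine ⟨K, fun x hx => ?_⟩
    have h := hK x hx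
    rw [taylorWithinEval_succ, taylor_within_zero_eval, iteratedDerivWithin_one,
      (hdiff a).derivWithin (uniqueDiffOn_Icc hab a ⟨le_rfl, hab.le⟩), hfa] at h
    simpa [Real.norm_eq_abs, mul_comm] using h
  set L := max K 0 with hL
  have hL0 : 0 ≤ L := le_max_right _ _
  set M := L / c with hM
  have hM0 : 0 ≤ M := div_nonneg hL0 hcpos.le
  have key : ∀ y ∈ Set.Ioo a (1 - η), |f y / (y - a) - deriv f a| ≤ M * f y := by
    intro y hy
    have hy' := Set.Ioo_subset_Icc_self hy
    have hp : 0 < y - a := sub_pos.2 hy.1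
    have e : f y / (y - a) - deriv f a = (f y - deriv f a * (y - a)) / (y - a) := by
      field_simp
    rw [e, abs_div, abs_of_pos hp, div_le_iff₀ hp]
    have h1 : L * (y - a) ^ 2 ≤ M * f y * (y - a) := by
      have h2 : L = M * c := by rw [hM]; field_simp
      rw [h2, ← hfg y]
      have h3 : M * c ≤ M * dslope f a y := mul_le_mul_of_nonneg_left (hcle y hy') hM0
      nlinarith [sq_nonneg (y - a)]
    have h4 : K * (y - a) ^ 2 ≤ L * (y - a) ^ 2 :=
      mul_le_mul_of_nonneg_right (le_max_left _ _) (sq_nonneg _)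
    linarith [hK y hy']
  refine ⟨Real.exp (-M), Real.exp_pos _, Real.exp M, Real.exp_pos _, ?_⟩
  intro ξ hξ τ hτ hY
  have hτm : τ ∈ Set.Icc 0 τ := ⟨hτ.le, le_rfl⟩
  have h0m : (0:ℝ) ∈ Set.Icc 0 τ := ⟨le_rfl, hτ.le⟩
  have hder : ∀ m : ℝ, ∀ s ∈ Set.Icc 0 τ, HasDerivAt
      (fun s => Real.log (Y s ξ - a) - deriv f a * s + m * Y s ξ)
      (f (Y s ξ) / (Y s ξ - a) - deriv f a + m * f (Y s ξ)) s := by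
    intro m s hs
    have h := hYode ξ s hs.1
    have hp : Y s ξ - a ≠ 0 := (sub_pos.2 (hY s hs).1).ne'
    have h1 := (h.sub_const a).log hp
    have h2 := (hasDerivAt_id s).const_mul (deriv f a)
    have h3 := (h1.sub h2).add (h.const_mul m)
    rw [mul_one] at h3
    exact h3
  have hmono : MonotoneOn (fun s => Real.log (Y s ξ - a) - deriv f a * s + M * Y s ξ)
      (Set.Icc 0 τ) := by
    refine monotoneOn_of_hasDerivWithinAt_nonneg (convex_Icc 0 τ)
      (fun s hs => (hder M s hs).continuousAt.continuousWithinAt)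
      (fun s hs => (hder M s (interior_subset hs)).hasDerivWithinAt) ?_
    intro s hs
    have := abs_le.1 (key _ (hY s (interior_subset hs)))
    linarith [this.1]
  have hanti : AntitoneOn (fun s => Real.log (Y s ξ - a) - deriv f a * s + (-M) * Y s ξ)
      (Set.Icc 0 τ) := by
    refine antitoneOn_of_hasDerivWithinAt_nonpos (convex_Icc 0 τ)
      (fun s hs => (hder (-M) s hs).continuousAt.continuousWithinAt)
      (fun s hs => (hder (-M) s (interior_subset hs)).hasDerivWithinAt) ?_
    intro s hs
    have := abs_le.1 (key _ (hY s (interior_subset hs)))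
    linarith [this.2]
  have hm := hmono h0m hτm hτ.le
  have hn := hanti h0m hτm hτ.le
  simp only [hY0, mul_zero, sub_zero] at hm hn
  have hYτ := hY τ hτm
  have hd : |Y τ ξ - ξ| ≤ 1 := by
    rw [abs_le]
    constructor <;> linarith [hYτ.1, hYτ.2, hξ.1, hξ.2]
  have hd' := abs_le.1 hd
  have hMa : M * (Y τ ξ - ξ) ≤ M := by nlinarith
  have hpξ : 0 < ξ - a := sub_pos.2 hξ.1
  have hpY : 0 < Y τ ξ - a := sub_pos.2 hYτ.1
  have e1 : Real.exp (Real.log (ξ - a)) = ξ - a := Real.exp_log hpξ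
  have e2 : Real.exp (Real.log (Y τ ξ - a)) = Y τ ξ - a := Real.exp_log hpY
  constructor
  · calc Real.exp (-M) * Real.exp (deriv f a * τ) * (ξ - a)
        = Real.exp (-M + deriv f a * τ + Real.log (ξ - a)) := by
          rw [Real.exp_add, Real.exp_add, e1]
      _ ≤ Real.exp (Real.log (Y τ ξ - a)) := Real.exp_le_exp.2 (by linarith)
      _ = Y τ ξ - a := e2
  · calc Y τ ξ - a = Real.exp (Real.log (Y τ ξ - a)) := e2.symm
      _ ≤ Real.exp (M + deriv f a * τ + Real.log (ξ - a)) := Real.exp_le_exp.2 (by linarith)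
      _ = Real.exp M * Real.exp (deriv f a * τ) * (ξ - a) := by
          rw [Real.exp_add, Real.exp_add, e1]
end
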